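/- For all integers n ≥ 1 and k ≥ 7, Γ_6(n,k) = 127·2^{6n} + (651·2^{k−3} − 10605)·2^{5n} + ((155/3)·2^{2k−3} − 22661·2^{k−3} + 748154/3)·2^{4n} + (1/168)·(2^{3k+3} − 16723·2^{2k} + 5026378·2^k − 382091648)·2^{3n} + (−(1/3)·2^{3k} + (5649/12)·2^{2k} − (368711/3)·2^k + 8753120)·2^{2n} + ((2/3)·2^{3k} − (2437/3)·2^{2k} + (597736/3)·2^k − 41276672/3)·2^n − 8·((1/21)·2^{3k} − (163/3)·2^{2k} + (38816/3)·2^k − 18483200/21), where all rational expressions combine to an integer identity. -/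

import Mathlib

open Finset

/-- The `2n × k` n-times persymmetric matrix over `F_2` associated to a parameter tuple
`alpha ∈ (F_2^{k+1})^n` : for `1 ≤ j ≤ n`, rows `2j-1` and `2j` are
`(alpha^(j)_1, ..., alpha^(j)_k)` and `(alpha^(j)_2, ..., alpha^(j)_{k+1})`. -/
def persymMatrix (n k : ℕ) (α : Fin n → Fin (k + 1) → ZMod 2) :
    Matrix (Fin (2 * n)) (Fin k) (ZMod 2) :=
  Matrix.of fun r c =>
    α ⟨r.val / 2, by have := r.isLt; omega⟩ ⟨r.val % 2 + c.val, by have := c.isLt; omega⟩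

/-- `Gamma n k i` is the number of parameter tuples `alpha ∈ (F_2^{k+1})^n` whose associated
n-times persymmetric `2n × k` matrix over `F_2` has rank `i`. -/
noncomputable def Gamma (n k i : ℕ) : ℕ :=
  Nat.card {α : Fin n → Fin (k + 1) → ZMod 2 // (persymMatrix n k α).rank = i}

namespace PersymCount

open Module

section counting

set_option linter.unusedSectionVars false

variable {V : Type} [AddCommGroup V] [Module (ZMod 2) V] [Fintype V]

/-- Span of all entries. -/
def tot {k : ℕ} (f : Fin k → V) : Submodule (ZMod 2) V :=
  Submodule.span (ZMod 2) (Set.range f)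

/-- Span of all entries but the first one. -/
def tl {k : ℕ} (f : Fin (k + 1) → V) : Submodule (ZMod 2) V :=
  Submodule.span (ZMod 2) (Set.range fun i : Fin k => f i.succ)

/-- Span of the pairs of consecutive entries. -/
def col {k : ℕ} (f : Fin (k + 1) → V) : Submodule (ZMod 2) (V × V) :=
  Submodule.span (ZMod 2) (Set.range fun i : Fin k => (f i.castSucc, f i.succ))

lemma map_snd_col {k : ℕ} (f : Fin (k + 1) → V) :
    (col f).map (LinearMap.snd (ZMod 2) V V) = tl f := by
  unfold col tl
  rw [Submodule.map_span, ← Set.range_comp]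
  rfl

lemma map_fst_col_le {k : ℕ} (f : Fin (k + 1) → V) :
    (col f).map (LinearMap.fst (ZMod 2) V V) ≤ tot f := by
  unfold col tot
  rw [Submodule.map_span, ← Set.range_comp]
  apply Submodule.span_mono
  rintro _ ⟨i, rfl⟩
  exact ⟨i.castSucc, rfl⟩

lemma tot_eq {k : ℕ} (f : Fin (k + 1) → V) :
    tot f = Submodule.span (ZMod 2) {f 0} ⊔ tl f := by
  unfold tot tl
  rw [← Submodule.span_union]
  congr 1
  ext x
  simp only [Set.mem_range, Set.mem_union, Set.mem_singleton_iff, Fin.exists_fin_succ]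
  exact or_congr_left eq_comm

lemma tl_cons {k : ℕ} (v : V) (f : Fin k → V) :
    tl (Fin.cons v f : Fin (k + 1) → V) = tot f := by
  simp [tl, tot]

lemma col_cons {k : ℕ} (v : V) (f : Fin (k + 1) → V) :
    col (Fin.cons v f : Fin (k + 2) → V) =
      Submodule.span (ZMod 2) {(v, f 0)} ⊔ col f := by
  unfold col
  rw [← Submodule.span_union]
  congr 1
  ext x
  simp only [Set.mem_range, Set.mem_union, Set.mem_singleton_iff, Fin.exists_fin_succ]
  refine or_congr ?_ ?_
  · simp [eq_comm]
  · simp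

lemma finrank_tl_le {k : ℕ} (f : Fin (k + 1) → V) : finrank (ZMod 2) (tl f) ≤ finrank (ZMod 2) (col f) := by
  rw [← map_snd_col]
  exact Submodule.finrank_map_le _ _

lemma finrank_sup_of_notMem {W : Type} [AddCommGroup W] [Module (ZMod 2) W] [Finite W]
    (p : Submodule (ZMod 2) W) (w : W) (hw : w ∉ p) :
    finrank (ZMod 2) (Submodule.span (ZMod 2) {w} ⊔ p : Submodule (ZMod 2) W)
      = finrank (ZMod 2) p + 1 := by
  have h := Submodule.finrank_sup_add_finrank_inf_eq (Submodule.span (ZMod 2) {w}) p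
  have hw0 : w ≠ 0 := fun h => hw (h ▸ p.zero_mem)
  have h1 : finrank (ZMod 2) (Submodule.span (ZMod 2) {w}) = 1 := finrank_span_singleton hw0
  have h2 : Submodule.span (ZMod 2) {w} ⊓ p = ⊥ := by
    rw [← disjoint_iff, disjoint_comm]
    exact (Submodule.disjoint_span_singleton' hw0).2 hw
  rw [h2, finrank_bot, h1] at h
  omega

lemma sup_of_mem {W : Type} [AddCommGroup W] [Module (ZMod 2) W]
    (p : Submodule (ZMod 2) W) (w : W) (hw : w ∈ p) :
    Submodule.span (ZMod 2) {w} ⊔ p = p := by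
  rw [sup_eq_right, Submodule.span_le]
  simpa using hw

open Classical in
lemma card_sub {W : Type} [AddCommGroup W] [Module (ZMod 2) W] [Fintype W]
    (p : Submodule (ZMod 2) W) :
    (univ.filter (fun v => v ∈ p)).card = 2 ^ finrank (ZMod 2) p := by
  have h := Module.card_eq_pow_finrank (K := ZMod 2) (V := p)
  rw [ZMod.card] at h
  rw [← h, Fintype.card_subtype]

open Classical in
lemma card_fiber {k : ℕ} (f : Fin (k + 1) → V) (h0 : f 0 ∈ tl f) :
    (univ.filter (fun v => (v, f 0) ∈ col f)).card
      = 2 ^ (finrank (ZMod 2) (col f) - finrank (ZMod 2) (tl f)) := by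
  have h0' := h0
  rw [← map_snd_col] at h0'
  obtain ⟨⟨w, y⟩, hw, hy⟩ := h0'
  simp only [LinearMap.snd_apply] at hy
  subst hy
  set K : Submodule (ZMod 2) V := (col f).comap (LinearMap.inl (ZMod 2) V V) with hK
  have hcard : (univ.filter (fun v => (v, f 0) ∈ col f)).card
      = (univ.filter (fun v => v ∈ K)).card := by
    apply Finset.card_bij' (fun v _ => v - w) (fun v _ => v + w)
    · intro v hv
      simp only [mem_filter, mem_univ, true_and] at hv ⊢
      simp only [hK, Submodule.mem_comap, LinearMap.inl_apply]
      simpa using (col f).sub_mem hv hw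
    · intro v hv
      simp only [mem_filter, mem_univ, true_and] at hv ⊢
      simp only [hK, Submodule.mem_comap, LinearMap.inl_apply] at hv
      simpa using (col f).add_mem hv hw
    · intro v _; simp
    · intro v _; simp
  rw [hcard, card_sub]
  congr 1
  have hr := LinearMap.finrank_range_add_finrank_ker
    ((LinearMap.snd (ZMod 2) V V).domRestrict (col f))
  rw [LinearMap.range_domRestrict, map_snd_col] at hr
  have hk : finrank (ZMod 2) (LinearMap.ker ((LinearMap.snd (ZMod 2) V V).domRestrict (col f)))
      = finrank (ZMod 2) K := by
    apply LinearEquiv.finrank_eq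
    refine LinearEquiv.ofBijective
      (LinearMap.codRestrict K ((LinearMap.fst (ZMod 2) V V) ∘ₗ (col f).subtype ∘ₗ
        (LinearMap.ker ((LinearMap.snd (ZMod 2) V V).domRestrict (col f))).subtype) ?_) ⟨?_, ?_⟩
    · rintro ⟨⟨⟨a, b⟩, h1⟩, h2⟩
      have hb : b = 0 := by simpa using h2
      subst hb
      simpa [hK] using h1
    · rintro ⟨⟨⟨a, b⟩, h1⟩, h2⟩ ⟨⟨⟨a', b'⟩, h1'⟩, h2'⟩ h
      have hb : b = 0 := by simpa using h2
      have hb' : b' = 0 := by simpa using h2'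
      have := congrArg Subtype.val h
      simp at this
      simp [this, hb, hb']
    · rintro ⟨a, ha⟩
      refine ⟨⟨⟨(a, 0), by simpa [hK] using ha⟩, by simp⟩, ?_⟩
      apply Subtype.ext
      simp
  omega

open Classical in
/-- Number of sequences in a given state, first entry in the span of the rest. -/
noncomputable def X (V : Type) [AddCommGroup V] [Module (ZMod 2) V] [Fintype V]
    (k r d : ℕ) : ℚ :=
  ∑ f : Fin (k + 1) → V, if f 0 ∈ tl f ∧ finrank (ZMod 2) (col f) = r ∧ finrank (ZMod 2) (tl f) = d
    then 1 else 0

open Classical in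
/-- Number of sequences in a given state, first entry not in the span of the rest. -/
noncomputable def Y (V : Type) [AddCommGroup V] [Module (ZMod 2) V] [Fintype V]
    (k r d : ℕ) : ℚ :=
  ∑ f : Fin (k + 1) → V, if f 0 ∉ tl f ∧ finrank (ZMod 2) (col f) = r ∧ finrank (ZMod 2) (tl f) = d
    then 1 else 0

lemma sum_cons (k : ℕ) (g : (Fin (k + 2) → V) → ℚ) :
    ∑ f, g f = ∑ f : Fin (k + 1) → V, ∑ v : V, g (Fin.cons v f) := by
  rw [← (Fin.consEquiv (fun _ : Fin (k + 2) => V)).sum_comp, Fintype.sum_prod_type, Finset.sum_comm]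
  rfl

lemma finrank_col_cons_mem {k : ℕ} (v : V) (f : Fin (k + 1) → V) (h : (v, f 0) ∈ col f) :
    finrank (ZMod 2) (col (Fin.cons v f : Fin (k + 2) → V)) = finrank (ZMod 2) (col f) := by
  rw [col_cons, sup_of_mem _ _ h]

lemma finrank_col_cons_notMem {k : ℕ} (v : V) (f : Fin (k + 1) → V) (h : (v, f 0) ∉ col f) :
    finrank (ZMod 2) (col (Fin.cons v f : Fin (k + 2) → V)) = finrank (ZMod 2) (col f) + 1 := by
  rw [col_cons, finrank_sup_of_notMem _ _ h]

lemma mem_tl_of {k : ℕ} (v : V) (f : Fin (k + 1) → V) (h : (v, f 0) ∈ col f) : f 0 ∈ tl f := by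
  rw [← map_snd_col]
  exact ⟨_, h, rfl⟩

lemma mem_tot_of {k : ℕ} (v : V) (f : Fin (k + 1) → V) (h : (v, f 0) ∈ col f) : v ∈ tot f :=
  map_fst_col_le f ⟨_, h, rfl⟩

open Classical in
lemma innerX {k : ℕ} (f : Fin (k + 1) → V) (r d : ℕ) :
    (∑ v : V, if (Fin.cons v f : Fin (k + 2) → V) 0 ∈ tl (Fin.cons v f : Fin (k + 2) → V) ∧
        finrank (ZMod 2) (col (Fin.cons v f : Fin (k + 2) → V)) = r ∧
        finrank (ZMod 2) (tl (Fin.cons v f : Fin (k + 2) → V)) = d then (1 : ℚ) else 0)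
    = 2 ^ (r - d) * (if f 0 ∈ tl f ∧ finrank (ZMod 2) (col f) = r ∧ finrank (ZMod 2) (tl f) = d
        then 1 else 0)
      + (2 ^ d - 2 ^ (r - 1 - d)) * (if f 0 ∈ tl f ∧ finrank (ZMod 2) (col f) + 1 = r ∧
          finrank (ZMod 2) (tl f) = d then 1 else 0)
      + 2 ^ d * (if f 0 ∉ tl f ∧ finrank (ZMod 2) (col f) + 1 = r ∧
          finrank (ZMod 2) (tl f) + 1 = d then 1 else 0) := by
  have hsum : (∑ v : V, if (Fin.cons v f : Fin (k + 2) → V) 0 ∈ tl (Fin.cons v f : Fin (k + 2) → V) ∧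
        finrank (ZMod 2) (col (Fin.cons v f : Fin (k + 2) → V)) = r ∧
        finrank (ZMod 2) (tl (Fin.cons v f : Fin (k + 2) → V)) = d then (1 : ℚ) else 0)
      = (if finrank (ZMod 2) (col f) = r ∧ finrank (ZMod 2) (tot f) = d then 1 else 0) *
          ((univ.filter (fun v => (v, f 0) ∈ col f)).card : ℚ)
        + (if finrank (ZMod 2) (col f) + 1 = r ∧ finrank (ZMod 2) (tot f) = d then 1 else 0) *
          (((univ.filter (fun v => v ∈ tot f)).card : ℚ)
            - ((univ.filter (fun v => (v, f 0) ∈ col f)).card : ℚ)) := by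
    simp only [Finset.card_filter, Nat.cast_sum, ← Finset.sum_sub_distrib, Finset.mul_sum,
      ← Finset.sum_add_distrib]
    refine Finset.sum_congr rfl fun v _ => ?_
    rw [tl_cons, Fin.cons_zero]
    by_cases h : (v, f 0) ∈ col f
    · have h2 := mem_tot_of v f h
      simp [finrank_col_cons_mem v f h, h, h2]
    · by_cases h2 : v ∈ tot f
      · simp [finrank_col_cons_notMem v f h, h, h2]
      · simp [h, h2]
  rw [hsum, card_sub]
  by_cases h0 : f 0 ∈ tl f
  · rw [card_fiber f h0]
    have ht : tot f = tl f := by rw [tot_eq, sup_of_mem _ _ h0]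
    rw [ht]
    simp only [h0, not_true_eq_false, true_and, false_and, if_false, mul_zero, add_zero]
    congr 1
    · split_ifs with h
      · obtain ⟨rfl, rfl⟩ := h; simp
      · simp
    · split_ifs with h
      · obtain ⟨rfl, rfl⟩ := h; simp
      · simp
  · have ht : finrank (ZMod 2) (tot f) = finrank (ZMod 2) (tl f) + 1 := by
      rw [tot_eq, finrank_sup_of_notMem _ _ h0]
    have he : (univ.filter (fun v => (v, f 0) ∈ col f)) = ∅ := by
      apply Finset.filter_false_of_mem
      intro v _ h
      exact h0 (mem_tl_of v f h)
    rw [he, ht]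
    simp only [h0, not_false_eq_true, true_and, false_and, if_false, mul_zero, zero_add,
      Finset.card_empty, Nat.cast_zero, sub_zero]
    split_ifs with h
    · obtain ⟨rfl, rfl⟩ := h; simp
    · simp

open Classical in
lemma innerY {k : ℕ} (f : Fin (k + 1) → V) (r d : ℕ) :
    (∑ v : V, if (Fin.cons v f : Fin (k + 2) → V) 0 ∉ tl (Fin.cons v f : Fin (k + 2) → V) ∧
        finrank (ZMod 2) (col (Fin.cons v f : Fin (k + 2) → V)) = r ∧
        finrank (ZMod 2) (tl (Fin.cons v f : Fin (k + 2) → V)) = d then (1 : ℚ) else 0)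
    = ((Fintype.card V : ℚ) - 2 ^ d) *
        ((if f 0 ∈ tl f ∧ finrank (ZMod 2) (col f) + 1 = r ∧
          finrank (ZMod 2) (tl f) = d then 1 else 0)
        + (if f 0 ∉ tl f ∧ finrank (ZMod 2) (col f) + 1 = r ∧
          finrank (ZMod 2) (tl f) + 1 = d then 1 else 0)) := by
  have hsum : (∑ v : V, if (Fin.cons v f : Fin (k + 2) → V) 0 ∉ tl (Fin.cons v f : Fin (k + 2) → V) ∧
        finrank (ZMod 2) (col (Fin.cons v f : Fin (k + 2) → V)) = r ∧
        finrank (ZMod 2) (tl (Fin.cons v f : Fin (k + 2) → V)) = d then (1 : ℚ) else 0)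
      = (if finrank (ZMod 2) (col f) + 1 = r ∧ finrank (ZMod 2) (tot f) = d then 1 else 0) *
          ((Fintype.card V : ℚ) - ((univ.filter (fun v => v ∈ tot f)).card : ℚ)) := by
    rw [← Finset.card_univ, Finset.card_eq_sum_ones]
    simp only [Finset.card_filter, Nat.cast_sum, ← Finset.sum_sub_distrib, Finset.mul_sum]
    refine Finset.sum_congr rfl fun v _ => ?_
    rw [tl_cons, Fin.cons_zero]
    by_cases h2 : v ∈ tot f
    · simp [h2]
    · have h : (v, f 0) ∉ col f := fun h => h2 (mem_tot_of v f h)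
      simp [finrank_col_cons_notMem v f h, h2]
  rw [hsum, card_sub]
  by_cases h0 : f 0 ∈ tl f
  · have ht : tot f = tl f := by rw [tot_eq, sup_of_mem _ _ h0]
    rw [ht]
    simp only [h0, not_true_eq_false, true_and, false_and, if_false, add_zero]
    split_ifs with h
    · obtain ⟨rfl, rfl⟩ := h; simp
    · simp
  · have ht : finrank (ZMod 2) (tot f) = finrank (ZMod 2) (tl f) + 1 := by
      rw [tot_eq, finrank_sup_of_notMem _ _ h0]
    rw [ht]
    simp only [h0, not_false_eq_true, true_and, false_and, if_false, zero_add]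
    split_ifs with h
    · obtain ⟨rfl, rfl⟩ := h; simp
    · simp

open Classical in
lemma X_succ (k r d : ℕ) : X V (k + 1) (r + 1) (d + 1) =
    2 ^ (r - d) * X V k (r + 1) (d + 1) + (2 ^ (d + 1) - 2 ^ (r - (d + 1))) * X V k r (d + 1)
      + 2 ^ (d + 1) * Y V k r d := by
  unfold X Y
  rw [sum_cons]
  simp only [innerX, Finset.sum_add_distrib, ← Finset.mul_sum, Nat.add_right_cancel_iff,
    Nat.add_sub_add_right, Nat.add_sub_cancel]

open Classical in
lemma Y_succ (k r d : ℕ) : Y V (k + 1) (r + 1) (d + 1) =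
    ((Fintype.card V : ℚ) - 2 ^ (d + 1)) * (X V k r (d + 1) + Y V k r d) := by
  unfold X Y
  rw [sum_cons]
  simp only [innerY, Finset.sum_add_distrib, ← Finset.mul_sum, Nat.add_right_cancel_iff]

open Classical in
lemma Y_succ_zero (k r : ℕ) : Y V (k + 1) (r + 1) 0 =
    ((Fintype.card V : ℚ) - 1) * X V k r 0 := by
  unfold X Y
  rw [sum_cons]
  simp only [innerY]
  simp [Finset.sum_ite, mul_comm]
  ring

open Classical in
lemma Y_succ_row (k d : ℕ) : Y V (k + 1) 0 d = 0 := by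
  unfold Y
  rw [sum_cons]
  simp only [innerY]
  simp

open Classical in
lemma X_succ_zero (k r : ℕ) : X V (k + 1) (r + 1) 0 =
    2 ^ (r + 1) * X V k (r + 1) 0 + (1 - 2 ^ r) * X V k r 0 := by
  unfold X
  rw [sum_cons]
  simp only [innerX]
  simp [Finset.sum_add_distrib, Finset.sum_ite, mul_comm]
  ring

open Classical in
lemma X_succ_row (k d : ℕ) : X V (k + 1) 0 d = X V k 0 d := by
  unfold X
  rw [sum_cons]
  simp only [innerX]
  simp

lemma tl_zero (f : Fin 1 → V) : tl f = ⊥ := by simp [tl]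
lemma col_zero (f : Fin 1 → V) : col f = ⊥ := by simp [col]
lemma finrank_tl_zero (f : Fin 1 → V) : finrank (ZMod 2) (tl f) = 0 := by rw [tl_zero, finrank_bot]
lemma finrank_col_zero (f : Fin 1 → V) : finrank (ZMod 2) (col f) = 0 := by
  rw [col_zero, finrank_bot]

open Classical in
lemma X_zero (r d : ℕ) : X V 0 r d = if r = 0 ∧ d = 0 then 1 else 0 := by
  unfold X
  simp only [finrank_tl_zero, finrank_col_zero, tl_zero, Submodule.mem_bot]
  rw [← (Equiv.funUnique (Fin 1) V).symm.sum_comp]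
  by_cases h : r = 0 ∧ d = 0
  · obtain ⟨rfl, rfl⟩ := h
    simp
  · rw [if_neg h]
    apply Finset.sum_eq_zero
    intro x _
    rw [if_neg]
    rintro ⟨_, h1, h2⟩
    exact h ⟨h1.symm, h2.symm⟩

open Classical in
lemma Y_zero (r d : ℕ) : Y V 0 r d = if r = 0 ∧ d = 0 then (Fintype.card V : ℚ) - 1 else 0 := by
  unfold Y
  simp only [finrank_tl_zero, finrank_col_zero, tl_zero, Submodule.mem_bot]
  rw [← (Equiv.funUnique (Fin 1) V).symm.sum_comp]
  by_cases h : r = 0 ∧ d = 0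
  · obtain ⟨rfl, rfl⟩ := h
    have h1 : ∀ x : V, (if ¬ x = 0 then (1 : ℚ) else 0) = 1 - if x = 0 then 1 else 0 := by
      intro x; split_ifs <;> simp_all
    simp [h1]
  · rw [if_neg h]
    apply Finset.sum_eq_zero
    intro x _
    rw [if_neg]
    rintro ⟨_, h1, h2⟩
    exact h ⟨h1.symm, h2.symm⟩

end counting

/-- The normalised recursion. -/
def st : ℕ → ℕ → ℕ → ℚ × ℚ
  | 0, 0, 0 => (1, 1)
  | 0, 0, _ + 1 => (0, 0)
  | 0, _ + 1, _ => (0, 0)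
  | k + 1, 0, d => ((st k 0 d).1, 0)
  | k + 1, r + 1, 0 => (2 ^ (r + 1) * (st k (r + 1) 0).1 + (1 - 2 ^ r) * (st k r 0).1, (st k r 0).1)
  | k + 1, r + 1, d + 1 =>
    (2 ^ (r - d) * (st k (r + 1) (d + 1)).1 + (2 ^ (d + 1) - 2 ^ (r - (d + 1))) * (st k r (d + 1)).1
      + 2 ^ (d + 1) * (st k r d).2, (st k r (d + 1)).1 + (st k r d).2)

/-- The number of linearly independent `d`-tuples. -/
def fp (N : ℚ) (d : ℕ) : ℚ := ∏ i ∈ Finset.range d, (N - 2 ^ i)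

lemma XY_eq (V : Type) [AddCommGroup V] [Module (ZMod 2) V] [Fintype V] (k : ℕ) :
    ∀ r d, X V k r d = fp (Fintype.card V) d * (st k r d).1 ∧
      Y V k r d = fp (Fintype.card V) (d + 1) * (st k r d).2 := by
  have hfp : ∀ N d, fp N (d + 1) = fp N d * (N - 2 ^ d) := fun N d => Finset.prod_range_succ _ _
  have hfp0 : ∀ N, fp N 0 = 1 := fun N => rfl
  induction k with
  | zero =>
    intro r d
    rw [X_zero, Y_zero]
    rcases r with _ | r <;> rcases d with _ | d <;> simp [st, fp]
  | succ k ih =>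
    intro r d
    rcases r with _ | r
    · rw [X_succ_row, Y_succ_row, (ih 0 d).1]
      simp [st]
    · rcases d with _ | d
      · rw [X_succ_zero, Y_succ_zero, (ih _ _).1, (ih _ _).1]
        simp only [st, hfp, hfp0]
        constructor <;> ring
      · rw [X_succ, Y_succ, (ih _ _).1, (ih _ _).1, (ih _ _).2]
        simp only [st, hfp]
        constructor <;> ring

lemma st_zero (k : ℕ) : ∀ r d, ((r < d ∨ 2 * d + 1 ≤ r) → (st k r d).1 = 0) ∧
    ((r < d ∨ 2 * d + 1 < r) → (st k r d).2 = 0) := by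
  induction k with
  | zero =>
    intro r d
    rcases r with _ | r <;> rcases d with _ | d <;> simp [st]
  | succ k ih =>
    intro r d
    rcases r with _ | r
    · simp only [st]
      exact ⟨fun h => (ih 0 d).1 h, fun _ => trivial⟩
    · rcases d with _ | d
      · simp only [st]
        constructor
        · intro h
          rw [(ih (r + 1) 0).1 h]
          rcases r with _ | r
          · simp
          · rw [(ih (r + 1) 0).1 (by omega)]; simp
        · intro h
          exact (ih r 0).1 (by omega)
      · simp only [st]
        constructor
        · intro h
          rw [(ih (r + 1) (d + 1)).1 h, (ih r d).2 (by omega)]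
          by_cases h2 : r = 2 * (d + 1)
          · have : r - (d + 1) = d + 1 := by omega
            rw [this]; simp
          · rw [(ih r (d + 1)).1 (by omega)]; simp
        · intro h
          rw [(ih r (d + 1)).1 (by omega), (ih r d).2 (by omega), add_zero]

lemma st_zero_x (k r d : ℕ) (h : r < d ∨ 2 * d + 1 ≤ r) : (st k r d).1 = 0 := (st_zero k r d).1 h

lemma st_zero_y (k r d : ℕ) (h : r < d ∨ 2 * d + 1 < r) : (st k r d).2 = 0 := (st_zero k r d).2 h

lemma x_0_0 (k : ℕ) (hk : 0 ≤ k) : (st k 0 0).1 = (1) := by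
  induction k with
  | zero => simp [st]
  | succ m ih => simpa [st] using ih (by omega)

lemma y_0_0 (k : ℕ) (hk : 1 ≤ k) : (st k 0 0).2 = 0 := by
  obtain ⟨m, rfl⟩ : ∃ m, k = m + 1 := ⟨k - 1, by omega⟩
  simp [st]

lemma y_1_0 (k : ℕ) (hk : 1 ≤ k) : (st k 1 0).2 = (1) := by
  obtain ⟨m, rfl⟩ : ∃ m, k = m + 1 := ⟨k - 1, by omega⟩
  simp only [st]
  rw [x_0_0 m (by omega)]

lemma x_1_1 (k : ℕ) (hk : 1 ≤ k) : (st k 1 1).1 = (2) := by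
  induction k, hk using Nat.le_induction with
  | base => norm_num [st]
  | succ m hm ih =>
    simp only [st]
    rw [ih, st_zero_x m 0 1 (by omega), y_0_0 m (by omega)]
    ring

lemma y_1_1 (k : ℕ) (hk : 2 ≤ k) : (st k 1 1).2 = 0 := by
  obtain ⟨m, rfl⟩ : ∃ m, k = m + 1 := ⟨k - 1, by omega⟩
  simp only [st]
  rw [st_zero_x m 0 1 (by omega), y_0_0 m (by omega)]
  ring

lemma x_2_1 (k : ℕ) (hk : 1 ≤ k) : (st k 2 1).1 = (-4) + (2) * 2 ^ k := by
  induction k, hk using Nat.le_induction with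
  | base => norm_num [st]
  | succ m hm ih =>
    simp only [st]
    rw [ih, x_1_1 m (by omega), y_1_0 m (by omega)]
    ring

lemma y_2_1 (k : ℕ) (hk : 2 ≤ k) : (st k 2 1).2 = (3) := by
  obtain ⟨m, rfl⟩ : ∃ m, k = m + 1 := ⟨k - 1, by omega⟩
  simp only [st]
  rw [x_1_1 m (by omega), y_1_0 m (by omega)]
  ring

lemma x_2_2 (k : ℕ) (hk : 2 ≤ k) : (st k 2 2).1 = (4) := by
  induction k, hk using Nat.le_induction with
  | base => norm_num [st]
  | succ m hm ih =>
    simp only [st]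
    rw [ih, st_zero_x m 1 2 (by omega), y_1_1 m (by omega)]
    ring

lemma y_2_2 (k : ℕ) (hk : 3 ≤ k) : (st k 2 2).2 = 0 := by
  obtain ⟨m, rfl⟩ : ∃ m, k = m + 1 := ⟨k - 1, by omega⟩
  simp only [st]
  rw [st_zero_x m 1 2 (by omega), y_1_1 m (by omega)]
  ring

lemma y_3_1 (k : ℕ) (hk : 2 ≤ k) : (st k 3 1).2 = (-4) + (1) * 2 ^ k := by
  obtain ⟨m, rfl⟩ : ∃ m, k = m + 1 := ⟨k - 1, by omega⟩
  simp only [st]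
  rw [x_2_1 m (by omega), st_zero_y m 2 0 (by omega)]
  ring

lemma x_3_2 (k : ℕ) (hk : 2 ≤ k) : (st k 3 2).1 = (-24) + (6) * 2 ^ k := by
  induction k, hk using Nat.le_induction with
  | base => norm_num [st]
  | succ m hm ih =>
    simp only [st]
    rw [ih, x_2_2 m (by omega), y_2_1 m (by omega)]
    ring

lemma y_3_2 (k : ℕ) (hk : 3 ≤ k) : (st k 3 2).2 = (7) := by
  obtain ⟨m, rfl⟩ : ∃ m, k = m + 1 := ⟨k - 1, by omega⟩
  simp only [st]
  rw [x_2_2 m (by omega), y_2_1 m (by omega)]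
  ring

lemma x_3_3 (k : ℕ) (hk : 3 ≤ k) : (st k 3 3).1 = (8) := by
  induction k, hk using Nat.le_induction with
  | base => norm_num [st]
  | succ m hm ih =>
    simp only [st]
    rw [ih, st_zero_x m 2 3 (by omega), y_2_2 m (by omega)]
    ring

lemma y_3_3 (k : ℕ) (hk : 4 ≤ k) : (st k 3 3).2 = 0 := by
  obtain ⟨m, rfl⟩ : ∃ m, k = m + 1 := ⟨k - 1, by omega⟩
  simp only [st]
  rw [st_zero_x m 2 3 (by omega), y_2_2 m (by omega)]
  ring

lemma x_4_2 (k : ℕ) (hk : 2 ≤ k) : (st k 4 2).1 = (64/3) + (-8) * 2 ^ k + (2/3) * (2 ^ k) ^ 2 := by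
  induction k, hk using Nat.le_induction with
  | base => norm_num [st]
  | succ m hm ih =>
    simp only [st]
    rw [ih, x_3_2 m (by omega), y_3_1 m (by omega)]
    ring

lemma y_4_2 (k : ℕ) (hk : 3 ≤ k) : (st k 4 2).2 = (-28) + (7/2) * 2 ^ k := by
  obtain ⟨m, rfl⟩ : ∃ m, k = m + 1 := ⟨k - 1, by omega⟩
  simp only [st]
  rw [x_3_2 m (by omega), y_3_1 m (by omega)]
  ring

lemma x_4_3 (k : ℕ) (hk : 3 ≤ k) : (st k 4 3).1 = (-112) + (14) * 2 ^ k := by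
  induction k, hk using Nat.le_induction with
  | base => norm_num [st]
  | succ m hm ih =>
    simp only [st]
    rw [ih, x_3_3 m (by omega), y_3_2 m (by omega)]
    ring

lemma y_4_3 (k : ℕ) (hk : 4 ≤ k) : (st k 4 3).2 = (15) := by
  obtain ⟨m, rfl⟩ : ∃ m, k = m + 1 := ⟨k - 1, by omega⟩
  simp only [st]
  rw [x_3_3 m (by omega), y_3_2 m (by omega)]
  ring

lemma x_4_4 (k : ℕ) (hk : 4 ≤ k) : (st k 4 4).1 = (16) := by
  induction k, hk using Nat.le_induction with
  | base => norm_num [st]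
  | succ m hm ih =>
    simp only [st]
    rw [ih, st_zero_x m 3 4 (by omega), y_3_3 m (by omega)]
    ring

lemma y_4_4 (k : ℕ) (hk : 5 ≤ k) : (st k 4 4).2 = 0 := by
  obtain ⟨m, rfl⟩ : ∃ m, k = m + 1 := ⟨k - 1, by omega⟩
  simp only [st]
  rw [st_zero_x m 3 4 (by omega), y_3_3 m (by omega)]
  ring

lemma y_5_2 (k : ℕ) (hk : 3 ≤ k) : (st k 5 2).2 = (64/3) + (-4) * 2 ^ k + (1/6) * (2 ^ k) ^ 2 := by
  obtain ⟨m, rfl⟩ : ∃ m, k = m + 1 := ⟨k - 1, by omega⟩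
  simp only [st]
  rw [x_4_2 m (by omega), st_zero_y m 4 1 (by omega)]
  ring

lemma x_5_3 (k : ℕ) (hk : 3 ≤ k) : (st k 5 3).1 = (896/3) + (-56) * 2 ^ k + (7/3) * (2 ^ k) ^ 2 := by
  induction k, hk using Nat.le_induction with
  | base => norm_num [st]
  | succ m hm ih =>
    simp only [st]
    rw [ih, x_4_3 m (by omega), y_4_2 m (by omega)]
    ring

lemma y_5_3 (k : ℕ) (hk : 4 ≤ k) : (st k 5 3).2 = (-140) + (35/4) * 2 ^ k := by
  obtain ⟨m, rfl⟩ : ∃ m, k = m + 1 := ⟨k - 1, by omega⟩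
  simp only [st]
  rw [x_4_3 m (by omega), y_4_2 m (by omega)]
  ring

lemma x_5_4 (k : ℕ) (hk : 4 ≤ k) : (st k 5 4).1 = (-480) + (30) * 2 ^ k := by
  induction k, hk using Nat.le_induction with
  | base => norm_num [st]
  | succ m hm ih =>
    simp only [st]
    rw [ih, x_4_4 m (by omega), y_4_3 m (by omega)]
    ring

lemma y_5_4 (k : ℕ) (hk : 5 ≤ k) : (st k 5 4).2 = (31) := by
  obtain ⟨m, rfl⟩ : ∃ m, k = m + 1 := ⟨k - 1, by omega⟩
  simp only [st]
  rw [x_4_4 m (by omega), y_4_3 m (by omega)]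
  ring

lemma x_5_5 (k : ℕ) (hk : 5 ≤ k) : (st k 5 5).1 = (32) := by
  induction k, hk using Nat.le_induction with
  | base => norm_num [st]
  | succ m hm ih =>
    simp only [st]
    rw [ih, st_zero_x m 4 5 (by omega), y_4_4 m (by omega)]
    ring

lemma y_5_5 (k : ℕ) (hk : 6 ≤ k) : (st k 5 5).2 = 0 := by
  obtain ⟨m, rfl⟩ : ∃ m, k = m + 1 := ⟨k - 1, by omega⟩
  simp only [st]
  rw [st_zero_x m 4 5 (by omega), y_4_4 m (by omega)]
  ring

lemma x_6_3 (k : ℕ) (hk : 3 ≤ k) : (st k 6 3).1 = (-4096/21) + (128/3) * 2 ^ k + (-8/3) * (2 ^ k) ^ 2 + (1/21) * (2 ^ k) ^ 3 := by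
  induction k, hk using Nat.le_induction with
  | base => norm_num [st]
  | succ m hm ih =>
    simp only [st]
    rw [ih, x_5_3 m (by omega), y_5_2 m (by omega)]
    ring

lemma y_6_3 (k : ℕ) (hk : 4 ≤ k) : (st k 6 3).2 = (320) + (-30) * 2 ^ k + (5/8) * (2 ^ k) ^ 2 := by
  obtain ⟨m, rfl⟩ : ∃ m, k = m + 1 := ⟨k - 1, by omega⟩
  simp only [st]
  rw [x_5_3 m (by omega), y_5_2 m (by omega)]
  ring

lemma x_6_4 (k : ℕ) (hk : 4 ≤ k) : (st k 6 4).1 = (8960/3) + (-280) * 2 ^ k + (35/6) * (2 ^ k) ^ 2 := by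
  induction k, hk using Nat.le_induction with
  | base => norm_num [st]
  | succ m hm ih =>
    simp only [st]
    rw [ih, x_5_4 m (by omega), y_5_3 m (by omega)]
    ring

lemma y_6_4 (k : ℕ) (hk : 5 ≤ k) : (st k 6 4).2 = (-620) + (155/8) * 2 ^ k := by
  obtain ⟨m, rfl⟩ : ∃ m, k = m + 1 := ⟨k - 1, by omega⟩
  simp only [st]
  rw [x_5_4 m (by omega), y_5_3 m (by omega)]
  ring

lemma x_6_5 (k : ℕ) (hk : 5 ≤ k) : (st k 6 5).1 = (-1984) + (62) * 2 ^ k := by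
  induction k, hk using Nat.le_induction with
  | base => norm_num [st]
  | succ m hm ih =>
    simp only [st]
    rw [ih, x_5_5 m (by omega), y_5_4 m (by omega)]
    ring

lemma y_6_5 (k : ℕ) (hk : 6 ≤ k) : (st k 6 5).2 = (63) := by
  obtain ⟨m, rfl⟩ : ∃ m, k = m + 1 := ⟨k - 1, by omega⟩
  simp only [st]
  rw [x_5_5 m (by omega), y_5_4 m (by omega)]
  ring

lemma x_6_6 (k : ℕ) (hk : 6 ≤ k) : (st k 6 6).1 = (64) := by
  induction k, hk using Nat.le_induction with
  | base => norm_num [st]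
  | succ m hm ih =>
    simp only [st]
    rw [ih, st_zero_x m 5 6 (by omega), y_5_5 m (by omega)]
    ring

lemma y_6_6 (k : ℕ) (hk : 7 ≤ k) : (st k 6 6).2 = 0 := by
  obtain ⟨m, rfl⟩ : ∃ m, k = m + 1 := ⟨k - 1, by omega⟩
  simp only [st]
  rw [st_zero_x m 5 6 (by omega), y_5_5 m (by omega)]
  ring

/-- Interleaving of two vectors. -/
def interleave (n : ℕ) :
    ((Fin n → ZMod 2) × (Fin n → ZMod 2)) →ₗ[ZMod 2] (Fin (2 * n) → ZMod 2) where
  toFun p := fun r => if r.val % 2 = 0 then p.1 ⟨r.val / 2, by have := r.isLt; omega⟩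
    else p.2 ⟨r.val / 2, by have := r.isLt; omega⟩
  map_add' p q := by
    ext r
    simp only [Prod.fst_add, Prod.snd_add, Pi.add_apply]
    split_ifs <;> rfl
  map_smul' c p := by
    ext r
    simp only [Prod.smul_fst, Prod.smul_snd, Pi.smul_apply, RingHom.id_apply]
    split_ifs <;> rfl

lemma interleave_injective (n : ℕ) : Function.Injective (interleave n) := by
  intro p q h
  apply Prod.ext
  · funext j
    have := congrFun h ⟨2 * j.val, by have := j.isLt; omega⟩
    simpa [interleave] using this
  · funext j
    have := congrFun h ⟨2 * j.val + 1, by have := j.isLt; omega⟩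
    have h2 : (2 * j.val + 1) / 2 = j.val := by omega
    simpa [interleave, h2, Nat.add_mod] using this

lemma rank_persym (n k : ℕ) (α : Fin n → Fin (k + 1) → ZMod 2) :
    (persymMatrix n k α).rank = finrank (ZMod 2) (col (fun i j => α j i)) := by
  rw [Matrix.rank_eq_finrank_span_cols, col,
    (Submodule.equivMapOfInjective _ (interleave_injective n) _).finrank_eq, Submodule.map_span,
    ← Set.range_comp]
  suffices h : (persymMatrix n k α).col = ⇑(interleave n) ∘
      fun i : Fin k => ((fun j => α j i.castSucc : Fin n → ZMod 2), fun j => α j i.succ) by rw [h]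
  funext c
  funext r
  simp only [Function.comp_apply, interleave, LinearMap.coe_mk, AddHom.coe_mk, persymMatrix,
    Matrix.col_apply, Matrix.of_apply]
  split_ifs with h
  · congr 1; ext; simp [h]
  · have : r.val % 2 = 1 := by omega
    congr 1; ext; simp [this, add_comm]

lemma Gamma_eq (n k r : ℕ) : (Gamma n k r : ℚ) =
    ∑ d ∈ Finset.range (r + 1), (X (Fin n → ZMod 2) k r d + Y (Fin n → ZMod 2) k r d) := by
  classical
  have h1 : Gamma n k r = (univ.filter (fun f : Fin (k + 1) → Fin n → ZMod 2 =>
      finrank (ZMod 2) (col f) = r)).card := by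
    unfold Gamma
    rw [← Fintype.card_subtype, ← Nat.card_eq_fintype_card]
    apply Nat.card_congr
    refine Equiv.subtypeEquiv (Equiv.piComm _) ?_
    intro α
    rw [rank_persym]
    rfl
  rw [h1, Finset.card_filter]
  unfold X Y
  simp only [← Finset.sum_add_distrib]
  rw [Finset.sum_comm]
  push_cast
  refine Finset.sum_congr rfl fun f _ => ?_
  by_cases hr : finrank (ZMod 2) (col f) = r
  · have hle := finrank_tl_le f
    rw [Finset.sum_eq_single (finrank (ZMod 2) (tl f))]
    · by_cases h0 : f 0 ∈ tl f <;> simp [hr, h0]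
    · intro b _ hb
      simp [Ne.symm hb]
    · intro h
      exact absurd (Finset.mem_range.2 (by omega)) h
  · simp [hr]

end PersymCount

open PersymCount in
theorem gamma_six (n k : ℕ) (hn : 1 ≤ n) (hk : 7 ≤ k) :
    (Gamma n k 6 : ℚ) =
      127 * 2 ^ (6 * n) + (651 * 2 ^ (k - 3) - 10605) * 2 ^ (5 * n)
        + ((155 / 3) * 2 ^ (2 * k - 3) - 22661 * 2 ^ (k - 3) + 748154 / 3) * 2 ^ (4 * n)
        + (1 / 168) * (2 ^ (3 * k + 3) - 16723 * 2 ^ (2 * k) + 5026378 * 2 ^ k - 382091648)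
            * 2 ^ (3 * n)
        + (-((1 / 3) * 2 ^ (3 * k)) + (5649 / 12) * 2 ^ (2 * k) - (368711 / 3) * 2 ^ k
            + 8753120) * 2 ^ (2 * n)
        + ((2 / 3) * 2 ^ (3 * k) - (2437 / 3) * 2 ^ (2 * k) + (597736 / 3) * 2 ^ k
            - 41276672 / 3) * 2 ^ n
        - 8 * ((1 / 21) * 2 ^ (3 * k) - (163 / 3) * 2 ^ (2 * k) + (38816 / 3) * 2 ^ k
            - 18483200 / 21) := by
  have hcard : (Fintype.card (Fin n → ZMod 2) : ℚ) = 2 ^ n := by simp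
  rw [Gamma_eq]
  simp only [Finset.sum_range_succ, Finset.sum_range_zero, (XY_eq (Fin n → ZMod 2) k _ _).1, (XY_eq _ k _ _).2,
    hcard]
  rw [st_zero_x k 6 0 (by omega), st_zero_x k 6 1 (by omega), st_zero_x k 6 2 (by omega),
    st_zero_y k 6 0 (by omega), st_zero_y k 6 1 (by omega), st_zero_y k 6 2 (by omega),
    x_6_3 k (by omega), x_6_4 k (by omega), x_6_5 k (by omega), x_6_6 k (by omega),
    y_6_3 k (by omega), y_6_4 k (by omega), y_6_5 k (by omega), y_6_6 k (by omega)]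
  simp only [fp, Finset.prod_range_succ, Finset.prod_range_zero]
  obtain ⟨m, rfl⟩ : ∃ m, k = m + 3 := ⟨k - 3, by omega⟩
  rw [show m + 3 - 3 = m by omega, show 2 * (m + 3) - 3 = 2 * m + 3 by omega]
  have e1 : ∀ a : ℕ, (2 : ℚ) ^ (a * n) = (2 ^ n) ^ a := fun a => by rw [mul_comm, pow_mul]
  have e2 : ∀ a : ℕ, (2 : ℚ) ^ (a * m) = (2 ^ m) ^ a := fun a => by rw [mul_comm, pow_mul]
  simp only [mul_add, pow_add, e1, e2]
  generalize (2 : ℚ) ^ n = N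
  generalize (2 : ℚ) ^ m = M
  ring
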